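/- Let F = (V_0,…,V_{k−1}) be an isotropic partial flag of type d in V with completion (V̄_0,…,V̄_{2k−1}) and let c be an admissible sequence. Then 𝔦^F_c ⊆ 𝔭_F, the bracket satisfies [𝔭_F, 𝔦^F_c] ⊆ 𝔦^F_c, and for every linear automorphism g of V with ω(g(v),g(w)) = ω(v,w) for all v,w and with g(V_p) = V_p for all p = 0,…,k−1, and every x ∈ 𝔦^F_c, one has g∘x∘g⁻¹ ∈ 𝔦^F_c. -/

import Mathlib

open Module Submodule

noncomputable section

/-- The orthogonal `W^⊥ = {v : ω(v,w) = 0 for all w ∈ W}` of a subspace with respect to a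
bilinear form `ω`. -/
def ortho {V : Type*} [AddCommGroup V] [Module ℂ V]
    (ω : V →ₗ[ℂ] V →ₗ[ℂ] ℂ) (W : Submodule ℂ V) : Submodule ℂ V where
  carrier := {v | ∀ w ∈ W, ω v w = 0}
  zero_mem' := by intro w _; simp
  add_mem' := by
    intro a b ha hb w hw
    rw [map_add, LinearMap.add_apply, ha w hw, hb w hw, add_zero]
  smul_mem' := by
    intro t a ha w hw
    rw [map_smul, LinearMap.smul_apply, ha w hw, smul_zero]

/-- The completion `(V̄_0, …, V̄_{2k−1})` of an isotropic partial flag `(V_0, …, V_{k−1})`: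
`V̄_p = V_p` for `p ≤ k−1` and `V̄_p = (V_{2k−1−p})^⊥` for `k ≤ p ≤ 2k−1`. -/
def completion {V : Type*} [AddCommGroup V] [Module ℂ V]
    (ω : V →ₗ[ℂ] V →ₗ[ℂ] ℂ) {k : ℕ} (W : Fin k → Submodule ℂ V) :
    ℕ → Submodule ℂ V := fun p =>
  if h : p < k then W ⟨p, h⟩
  else if h2 : 2 * k - 1 - p < k then ortho ω (W ⟨2 * k - 1 - p, h2⟩) else ⊥

/-- An endomorphism `x` is skew-adjoint with respect to `ω` if `ω(x v, w) = −ω(v, x w)`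
for all `v, w`; this says `x ∈ 𝔤`. -/
def SkewAdjWrt {V : Type*} [AddCommGroup V] [Module ℂ V]
    (ω : V →ₗ[ℂ] V →ₗ[ℂ] ℂ) (x : Module.End ℂ V) : Prop :=
  ∀ v w, ω (x v) w = - ω v (x w)

/-- For an isotropic partial flag `F` of type `d` with completion `V̄` and
an admissible sequence `c`: the subspace `𝔦^F_c = {x ∈ 𝔤 : x(V̄_p) ⊆ V̄_{c_p}}` is contained
in `𝔭_F = {x ∈ 𝔤 : x(V_p) ⊆ V_p}`, satisfies `[𝔭_F, 𝔦^F_c] ⊆ 𝔦^F_c`, and is stable under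
conjugation by every `ω`-automorphism of `V` stabilizing the flag. -/
theorem stmt_9 (V : Type*) [AddCommGroup V] [Module ℂ V] [FiniteDimensional ℂ V]
    (m : ℕ) (hdimV : finrank ℂ V = m)
    (ω : V →ₗ[ℂ] V →ₗ[ℂ] ℂ)
    (hnd : ∀ v, (∀ w, ω v w = 0) → v = 0)
    (hso : (∀ v w, ω v w = ω w v) ∨ (∀ v, ω v v = 0))
    (k : ℕ) (hk : 2 ≤ k)
    (d : Fin k → ℕ) (hd0 : d ⟨0, by omega⟩ = 0) (hdsm : StrictMono d)
    (hdm : 2 * d ⟨k - 1, by omega⟩ ≤ m)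
    (F : Fin k → Submodule ℂ V) (hFmono : Monotone F)
    (hFiso : ∀ p, ∀ v ∈ F p, ∀ w ∈ F p, ω v w = 0)
    (hFdim : ∀ p, finrank ℂ (F p) = d p)
    (c : ℕ → ℕ) (hcmono : ∀ p q, p ≤ q → q < 2 * k → c p ≤ c q)
    (hcle : ∀ p < 2 * k, c p ≤ p) :
    (∀ x : Module.End ℂ V,
      (SkewAdjWrt ω x ∧
        ∀ p < 2 * k, (completion ω F p).map x ≤ completion ω F (c p)) →
      ∀ p, (F p).map x ≤ F p) ∧
    (∀ y x : Module.End ℂ V,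
      (SkewAdjWrt ω y ∧ ∀ p, (F p).map y ≤ F p) →
      (SkewAdjWrt ω x ∧
        ∀ p < 2 * k, (completion ω F p).map x ≤ completion ω F (c p)) →
      (SkewAdjWrt ω (y * x - x * y) ∧
        ∀ p < 2 * k, (completion ω F p).map (y * x - x * y) ≤ completion ω F (c p))) ∧
    (∀ g : V ≃ₗ[ℂ] V, (∀ v w, ω (g v) (g w) = ω v w) →
      (∀ p, (F p).map (g : V →ₗ[ℂ] V) = F p) →
      ∀ x : Module.End ℂ V,
        (SkewAdjWrt ω x ∧
          ∀ p < 2 * k, (completion ω F p).map x ≤ completion ω F (c p)) →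
        (SkewAdjWrt ω ((g : V →ₗ[ℂ] V) * x * (g.symm : V →ₗ[ℂ] V)) ∧
          ∀ p < 2 * k, (completion ω F p).map ((g : V →ₗ[ℂ] V) * x * (g.symm : V →ₗ[ℂ] V))
            ≤ completion ω F (c p))) := by
  have hlow : ∀ p : Fin k, completion ω F p = F p := by
    intro p; simp [completion]
  refine ⟨?_, ?_, ?_⟩
  · rintro x ⟨-, hx⟩ p
    have hp := p.2
    have h := hx p (by omega)
    have hc := hcle p (by omega)
    have hcp : c p < k := by omega
    rw [hlow p] at h
    have h2 := hlow ⟨c p, hcp⟩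
    simp only at h2
    rw [h2] at h
    exact h.trans (hFmono (by exact hc))
  · rintro y x ⟨hy, hyF⟩ ⟨hx, hxF⟩
    have hyC : ∀ p, ∀ v ∈ completion ω F p, y v ∈ completion ω F p := by
      intro p v hv
      unfold completion at hv ⊢
      split_ifs at hv ⊢ with h1 h2
      · exact hyF _ (Submodule.mem_map_of_mem hv)
      · intro w hw
        rw [hy, hv _ (hyF _ (Submodule.mem_map_of_mem hw)), neg_zero]
      · rw [Submodule.mem_bot] at hv ⊢
        rw [hv, map_zero]
    refine ⟨?_, ?_⟩
    · intro v w
      simp only [LinearMap.sub_apply, Module.End.mul_apply, map_sub]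
      rw [hy (x v), hx v, hx (y v), hy v]
      ring
    · rintro p hp _ ⟨v, hv, rfl⟩
      simp only [LinearMap.sub_apply, Module.End.mul_apply]
      exact Submodule.sub_mem _ (hyC _ _ (hxF p hp (Submodule.mem_map_of_mem hv)))
        (hxF p hp (Submodule.mem_map_of_mem (hyC _ _ hv)))
  · rintro g hg hgF x ⟨hx, hxF⟩
    have hF1 : ∀ p, ∀ v ∈ F p, g v ∈ F p := by
      intro p v hv
      have h := Submodule.mem_map_of_mem (f := (g : V →ₗ[ℂ] V)) hv
      rw [hgF p] at h
      exact h
    have hF2 : ∀ p, ∀ v ∈ F p, g.symm v ∈ F p := by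
      intro p v hv
      rw [← hgF p] at hv
      obtain ⟨u, hu, rfl⟩ := hv
      simpa using hu
    have hgs : ∀ v w, ω (g v) w = ω v (g.symm w) := by
      intro v w
      rw [← hg v, g.apply_symm_apply]
    have hgs2 : ∀ v w, ω (g.symm v) w = ω v (g w) := by
      intro v w
      rw [← hg (g.symm v), g.apply_symm_apply]
    have hC1 : ∀ p, ∀ v ∈ completion ω F p, g v ∈ completion ω F p := by
      intro p v hv
      unfold completion at hv ⊢
      split_ifs at hv ⊢ with h1 h2
      · exact hF1 _ _ hv
      · intro w hw
        rw [hgs]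
        exact hv _ (hF2 _ _ hw)
      · rw [Submodule.mem_bot] at hv ⊢
        rw [hv, map_zero]
    have hC2 : ∀ p, ∀ v ∈ completion ω F p, g.symm v ∈ completion ω F p := by
      intro p v hv
      unfold completion at hv ⊢
      split_ifs at hv ⊢ with h1 h2
      · exact hF2 _ _ hv
      · intro w hw
        rw [hgs2]
        exact hv _ (hF1 _ _ hw)
      · rw [Submodule.mem_bot] at hv ⊢
        rw [hv, map_zero]
    refine ⟨?_, ?_⟩
    · intro v w
      simp only [Module.End.mul_apply, LinearEquiv.coe_coe]
      rw [hgs, hx, hgs2]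
    · rintro p hp _ ⟨v, hv, rfl⟩
      simp only [Module.End.mul_apply, LinearEquiv.coe_coe]
      exact hC1 _ _ (hxF p hp (Submodule.mem_map_of_mem (hC2 _ _ hv)))
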